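/- Let κ(G) be an (ε,c)-kernel of a finite simple undirected graph G = (V,E) with c ≥ 1 and ε ∈ [0,1/3), and let M be a matching in κ(G) such that every augmenting path in κ(G) with respect to M has length at least five. Then M is a (3+3ε)-approximation to the maximum matching in G: for every matching M° in G, |M°| ≤ (3+3ε) · |M|. -/

import Mathlib

/-- `M` is a matching in the graph `H`: a set of edges of `H` that are pairwise
vertex-disjoint. -/
def IsMatchingOn {V : Type*} (H : SimpleGraph V) (M : Finset (Sym2 V)) : Prop :=
  (∀ e ∈ M, e ∈ H.edgeSet) ∧
  (∀ e ∈ M, ∀ f ∈ M, e ≠ f → ∀ v : V, v ∈ e → v ∉ f)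

/-- A vertex `v` is matched in the matching `M` if some edge of `M` is incident to it. -/
def Matched {V : Type*} (M : Finset (Sym2 V)) (v : V) : Prop :=
  ∃ e ∈ M, v ∈ e

/-- `K` (with tight-node set `T`) is an `(ε,c)`-kernel of `G`:
`K` is a subgraph of `G`, every node has at most `(1+ε)c` neighbors in `K`
(its "friends"), every tight node has at least `(1-ε)c` friends, and every edge of `G`
joining two slack (i.e. non-tight) nodes belongs to `K`. -/
def IsKernel {V : Type*} (G K : SimpleGraph V) (T : Set V) (ε c : ℝ) : Prop :=
  K ≤ G ∧
  (∀ v : V, ((K.neighborSet v).ncard : ℝ) ≤ (1 + ε) * c) ∧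
  (∀ v ∈ T, (1 - ε) * c ≤ ((K.neighborSet v).ncard : ℝ)) ∧
  (∀ u v : V, G.Adj u v → u ∉ T → v ∉ T → K.Adj u v)

/-- `p 0, p 1, …, p (2k+1)` is an augmenting path of length `2k+1` in the graph `H`
with respect to the matching `M`: the vertices are distinct, consecutive vertices are
adjacent in `H`, the edges alternate between edges outside `M` (for even edge index)
and edges of `M` (for odd edge index) — so the path starts and ends with edges outside
`M` — and both endpoints are unmatched in `M`. -/
def IsAugPath {V : Type*} (H : SimpleGraph V) (M : Finset (Sym2 V)) (k : ℕ)
    (p : ℕ → V) : Prop :=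
  (∀ i j, i ≤ 2 * k + 1 → j ≤ 2 * k + 1 → p i = p j → i = j) ∧
  (∀ i, i ≤ 2 * k → H.Adj (p i) (p (i + 1))) ∧
  (∀ i, i ≤ 2 * k → (s(p i, p (i + 1)) ∈ M ↔ Odd i)) ∧
  ¬ Matched M (p 0) ∧ ¬ Matched M (p (2 * k + 1))

/-- Two adjacent unmatched vertices form an augmenting path of length one. -/
theorem isAugPath_of_adj {V : Type*} {H : SimpleGraph V} {M : Finset (Sym2 V)} {u v : V}
    (huv : H.Adj u v) (hu : ¬ Matched M u) (hv : ¬ Matched M v) :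
    ∃ p, IsAugPath H M 0 p := by
  refine ⟨fun i => if i = 0 then u else v, ?_, ?_, ?_, by simpa using hu, by simpa using hv⟩
  · intro i j hi hj h
    have := huv.ne
    interval_cases i <;> interval_cases j <;> simp_all
  · intro i hi
    interval_cases i
    simpa using huv
  · intro i hi
    interval_cases i
    simpa using fun h => hu ⟨_, h, Sym2.mem_mk_left u v⟩

/-- A matched edge whose ends have distinct unmatched neighbors extends to an augmenting path
of length three. -/
theorem isAugPath_of_adj_of_adj {V : Type*} {H : SimpleGraph V} {M : Finset (Sym2 V)}
    {u a b w : V} (hab : H.Adj a b) (habM : s(a, b) ∈ M) (hua : H.Adj u a) (hwb : H.Adj w b)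
    (hu : ¬ Matched M u) (hw : ¬ Matched M w) (huw : u ≠ w) :
    ∃ p, IsAugPath H M 1 p := by
  have ha : Matched M a := ⟨_, habM, Sym2.mem_mk_left a b⟩
  have hb : Matched M b := ⟨_, habM, Sym2.mem_mk_right a b⟩
  have hua' : u ≠ a := fun h => hu (h ▸ ha)
  have hub' : u ≠ b := fun h => hu (h ▸ hb)
  have hwa' : w ≠ a := fun h => hw (h ▸ ha)
  have hwb' : w ≠ b := fun h => hw (h ▸ hb)
  have hab' := hab.ne
  have huM : s(u, a) ∉ M := fun h => hu ⟨_, h, Sym2.mem_mk_left u a⟩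
  have hwM : s(b, w) ∉ M := fun h => hw ⟨_, h, Sym2.mem_mk_right b w⟩
  refine ⟨fun i => if i = 0 then u else if i = 1 then a else if i = 2 then b else w,
    ?_, ?_, ?_, by simpa using hu, by simpa using hw⟩
  · intro i j hi hj h
    interval_cases i <;> interval_cases j <;> simp_all
  · intro i hi
    interval_cases i
    · simpa using hua
    · simpa using hab
    · simpa using hwb.symm
  · intro i hi
    interval_cases i
    · simpa using huM
    · simpa using habM
    · simpa [Nat.odd_iff] using hwM

/-- A matching is no larger than any vertex set that covers it. -/
theorem IsMatchingOn.card_le_of_cover {V : Type*} {H : SimpleGraph V} {M : Finset (Sym2 V)}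
    (hM : IsMatchingOn H M) (S : Finset V) (hS : ∀ e ∈ M, ∃ v ∈ S, v ∈ e) :
    M.card ≤ S.card := by
  rcases M.eq_empty_or_nonempty with rfl | ⟨e₀, he₀⟩
  · simp
  have : Nonempty V := ⟨(hS e₀ he₀).choose⟩
  choose! f hfS hf using hS
  refine Finset.card_le_card_of_injOn f hfS fun e he e' he' h => ?_
  by_contra hne
  exact hM.2 e he e' he' hne _ (hf e he) (h ▸ hf e' he')

open Classical in
/-- There are at most twice as many matched vertices as matching edges. -/
theorem card_filter_matched_le {V : Type*} [Fintype V] (M : Finset (Sym2 V)) :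
    (Finset.univ.filter (Matched M)).card ≤ 2 * M.card := by
  have hsub : Finset.univ.filter (Matched M) ⊆ M.biUnion Sym2.toFinset := by
    rintro v hv
    obtain ⟨e, he, hve⟩ := (Finset.mem_filter.1 hv).2
    exact Finset.mem_biUnion.2 ⟨e, he, Sym2.mem_toFinset.2 hve⟩
  refine (Finset.card_le_card hsub).trans ?_
  rw [mul_comm]
  refine Finset.card_biUnion_le_card_mul _ _ _ fun e _ => ?_
  rw [Sym2.card_toFinset]
  split_ifs <;> omega

open Classical in
/-- If there is no augmenting path of length three, the ends of a matched edge together have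
at most as many unmatched neighbors as the maximum degree. -/
theorem card_unmatched_neighbors_le {V : Type*} [Fintype V] {K : SimpleGraph V}
    {M : Finset (Sym2 V)} (hAug : ∀ p, ¬ IsAugPath K M 1 p) {D : ℝ}
    (hD : ∀ v, ((K.neighborSet v).ncard : ℝ) ≤ D) {a b : V} (hab : K.Adj a b)
    (habM : s(a, b) ∈ M) :
    (((Finset.univ.filter fun v => ¬ Matched M v ∧ K.Adj v a).card : ℝ) +
      (Finset.univ.filter fun v => ¬ Matched M v ∧ K.Adj v b).card) ≤ D := by
  have hdeg : ∀ (S : Finset V) (x : V), (∀ v ∈ S, K.Adj x v) → (S.card : ℝ) ≤ D := by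
    intro S x hS
    refine le_trans ?_ (hD x)
    rw [← Set.ncard_coe_finset]
    exact_mod_cast Set.ncard_le_ncard hS (Set.toFinite _)
  set A := Finset.univ.filter fun v => ¬ Matched M v ∧ K.Adj v a with hA
  set B := Finset.univ.filter fun v => ¬ Matched M v ∧ K.Adj v b with hB
  have hAD := hdeg A a fun v hv => (Finset.mem_filter.1 hv).2.2.symm
  have hBD := hdeg B b fun v hv => (Finset.mem_filter.1 hv).2.2.symm
  rcases A.eq_empty_or_nonempty with hA0 | ⟨u, hu⟩
  · simpa [hA0] using hBD
  rcases B.eq_empty_or_nonempty with hB0 | ⟨w, hw⟩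
  · simpa [hB0] using hAD
  have heq : ∀ x ∈ A, ∀ y ∈ B, x = y := by
    intro x hx y hy
    by_contra hne
    obtain ⟨hx, hxa⟩ := (Finset.mem_filter.1 hx).2
    obtain ⟨hy, hyb⟩ := (Finset.mem_filter.1 hy).2
    obtain ⟨p, hp⟩ := isAugPath_of_adj_of_adj hab habM hxa hyb hx hy hne
    exact hAug p hp
  have hA1 : A.card ≤ 1 := Finset.card_le_one.2 fun x hx y hy =>
    (heq x hx w hw).trans (heq y hy w hw).symm
  have hB1 : B.card ≤ 1 := Finset.card_le_one.2 fun x hx y hy =>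
    (heq u hu x hx).symm.trans (heq u hu y hy)
  obtain ⟨hu', hua⟩ := (Finset.mem_filter.1 hu).2
  have hub : u ≠ b := by
    rintro rfl
    exact hu' ⟨_, habM, Sym2.mem_mk_right a u⟩
  have h2 := hdeg {u, b} a (by simp [hua.symm, hab])
  rw [Finset.card_pair hub] at h2
  have : ((A.card + B.card : ℕ) : ℝ) ≤ (2 : ℕ) := by exact_mod_cast (by omega)
  push_cast at this h2
  linarith

open Classical in
/-- Double counting of the edges between unmatched vertices of large degree and matched vertices,
for a matching without augmenting paths of length one or three. -/
theorem card_mul_le_card_mul_of_unmatched {V : Type*} [Fintype V] {K : SimpleGraph V}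
    {M : Finset (Sym2 V)} (hM : IsMatchingOn K M) (hAug₀ : ∀ p, ¬ IsAugPath K M 0 p)
    (hAug₁ : ∀ p, ¬ IsAugPath K M 1 p) {d D : ℝ}
    (hD : ∀ v, ((K.neighborSet v).ncard : ℝ) ≤ D) (S : Finset V)
    (hS : ∀ v ∈ S, ¬ Matched M v) (hd : ∀ v ∈ S, d ≤ ((K.neighborSet v).ncard : ℝ)) :
    S.card * d ≤ M.card * D := by
  let N : V → Sym2 V → Finset V := fun v e => Finset.univ.filter fun w => w ∈ e ∧ K.Adj v w
  have hvertex : ∀ v ∈ S, d ≤ ∑ e ∈ M, ((N v e).card : ℝ) := by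
    intro v hv
    refine (hd v hv).trans ?_
    have hsub : K.neighborSet v ⊆ (M.biUnion (N v) : Finset V) := by
      intro w hw
      have hwM : Matched M w := by
        by_contra hwM
        obtain ⟨p, hp⟩ := isAugPath_of_adj hw (hS v hv) hwM
        exact hAug₀ p hp
      obtain ⟨e, he, hwe⟩ := hwM
      exact Finset.mem_coe.2 (Finset.mem_biUnion.2 ⟨e, he, by simpa [N, hwe] using hw⟩)
    have h := Set.ncard_le_ncard hsub (Set.toFinite _)
    rw [Set.ncard_coe_finset] at h
    exact_mod_cast h.trans Finset.card_biUnion_le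
  have hedge : ∀ e ∈ M, ∑ v ∈ S, ((N v e).card : ℝ) ≤ D := by
    intro e he
    induction e with
    | h a b =>
      refine le_trans ?_ (card_unmatched_neighbors_le hAug₁ hD (hM.1 _ he) he)
      have hN : ∀ v ∈ S, (N v s(a, b)).card ≤
          (if K.Adj v a then 1 else 0) + (if K.Adj v b then 1 else 0) := by
        intro v _
        have hsub : N v s(a, b) ⊆ (if K.Adj v a then {a} else ∅) ∪
            (if K.Adj v b then {b} else ∅) := by
          intro w hw
          obtain ⟨hw, hvw⟩ := (Finset.mem_filter.1 hw).2
          rcases Sym2.mem_iff.1 hw with rfl | rfl <;> simp [hvw]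
        refine (Finset.card_le_card hsub).trans ((Finset.card_union_le _ _).trans ?_)
        split_ifs <;> simp
      have hcount := Finset.sum_le_sum hN
      rw [Finset.sum_add_distrib, ← Finset.card_filter, ← Finset.card_filter] at hcount
      have hmono : ∀ x, (S.filter fun v => K.Adj v x).card ≤
          (Finset.univ.filter fun v => ¬ Matched M v ∧ K.Adj v x).card := by
        intro x
        refine Finset.card_le_card fun v hv => ?_
        obtain ⟨hv, hvx⟩ := Finset.mem_filter.1 hv
        simpa [hvx] using hS v hv
      exact_mod_cast hcount.trans (add_le_add (hmono a) (hmono b))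
  calc (S.card : ℝ) * d = ∑ v ∈ S, d := by simp
    _ ≤ ∑ v ∈ S, ∑ e ∈ M, ((N v e).card : ℝ) := Finset.sum_le_sum hvertex
    _ = ∑ e ∈ M, ∑ v ∈ S, ((N v e).card : ℝ) := Finset.sum_comm
    _ ≤ ∑ e ∈ M, D := Finset.sum_le_sum hedge
    _ = M.card * D := by simp

/-- Let `M` be a matching in an `(ε,c)`-kernel `K` of `G` (with `c ≥ 1`, `0 ≤ ε < 1/3`)
such that every augmenting path in `K` with respect to `M` has length at least five.
Then `M` is a `(3+3ε)`-approximate maximum matching of `G`. -/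
theorem stmt_12 {V : Type*} [Fintype V] (G K : SimpleGraph V) (T : Set V)
    (ε c : ℝ) (hc : 1 ≤ c) (hε0 : 0 ≤ ε) (hε : ε < 1 / 3)
    (hker : IsKernel G K T ε c)
    (M : Finset (Sym2 V)) (hM : IsMatchingOn K M)
    (hAug : ∀ (k : ℕ) (p : ℕ → V), IsAugPath K M k p → 5 ≤ 2 * k + 1)
    (Mo : Finset (Sym2 V)) (hMo : IsMatchingOn G Mo) :
    (Mo.card : ℝ) ≤ (3 + 3 * ε) * (M.card : ℝ) := by
  classical
  obtain ⟨-, hdeg, htight, hslack⟩ := hker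
  have hAug₀ : ∀ p, ¬ IsAugPath K M 0 p := fun p hp => by simpa using hAug 0 p hp
  have hAug₁ : ∀ p, ¬ IsAugPath K M 1 p := fun p hp => by simpa using hAug 1 p hp
  set S := Finset.univ.filter fun v => ¬ Matched M v ∧ v ∈ T
  have hS := card_mul_le_card_mul_of_unmatched hM hAug₀ hAug₁ hdeg S
    (fun v hv => (Finset.mem_filter.1 hv).2.1)
    (fun v hv => htight v (Finset.mem_filter.1 hv).2.2)
  have hcover : Mo.card ≤ (Finset.univ.filter (Matched M) ∪ S).card := by
    refine hMo.card_le_of_cover _ fun e he => ?_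
    induction e with
    | h u v =>
      by_contra! hcon
      have hout : ∀ w ∈ s(u, v), ¬ Matched M w ∧ w ∉ T := by
        intro w hw
        have hw' : w ∉ Finset.univ.filter (Matched M) ∪ S := fun h => hcon w h hw
        simp only [S, Finset.mem_union, Finset.mem_filter, Finset.mem_univ, true_and] at hw'
        tauto
      obtain ⟨hu, huT⟩ := hout u (Sym2.mem_mk_left u v)
      obtain ⟨hv, hvT⟩ := hout v (Sym2.mem_mk_right u v)
      obtain ⟨p, hp⟩ := isAugPath_of_adj (hslack u v (hMo.1 _ he) huT hvT) hu hv
      exact hAug₀ p hp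
  have hcard : (Mo.card : ℝ) ≤ 2 * M.card + S.card := by
    exact_mod_cast hcover.trans
      ((Finset.card_union_le _ _).trans (Nat.add_le_add_right (card_filter_matched_le M) _))
  have hS' : (S.card : ℝ) * (1 - ε) ≤ M.card * (1 + ε) := by
    refine le_of_mul_le_mul_right ?_ (by linarith : 0 < c)
    linarith
  have hm : (0 : ℝ) ≤ M.card := Nat.cast_nonneg _
  have hε' : 1 + ε ≤ (1 + 3 * ε) * (1 - ε) := by nlinarith
  have hSM : (S.card : ℝ) ≤ (1 + 3 * ε) * M.card := by
    refine le_of_mul_le_mul_right ?_ (by linarith : 0 < 1 - ε)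
    nlinarith [mul_le_mul_of_nonneg_left hε' hm]
  linarith
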